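/- arXiv:2012.14540 — 7 statements merged into one kernel-verified Lean document; each statement's English description precedes it below -/
import Mathlib

section
/- Let k ≥ 2, ζ > 0, and let v ∈ [0,1]^k be ζ-separated. Then for every i ∈ {1,…,k}, the coefficient norm of the i-th Lagrange interpolation polynomial of v satisfies ‖p_{v,i}‖_c ≤ (k−1)·(2/ζ)^{k−1}. -/
/-- The coefficient norm `‖p‖_c = ∑_{j=0}^{k-1} j |p_j|` of a polynomial of degree `< k`. -/
noncomputable def coeffNorm (k : ℕ) (p : Polynomial ℝ) : ℝ :=
  ∑ j ∈ Finset.range k, (j : ℝ) * |p.coeff j|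

/-- A product of `n` linear factors `a (X - y)` with `|a| ≤ c` and `|y| ≤ 1` is dominated
coefficientwise by `(c (X + 1)) ^ n`. -/
theorem abs_coeff_prod_linear_le {ι : Type*} (s : Finset ι) (a y : ι → ℝ) (c : ℝ)
    (ha : ∀ j ∈ s, |a j| ≤ c) (hy : ∀ j ∈ s, |y j| ≤ 1) (m : ℕ) :
    |(∏ j ∈ s, Polynomial.C (a j) * (Polynomial.X - Polynomial.C (y j))).coeff m| ≤
      c ^ s.card * (s.card.choose m : ℝ) := by
  classical
  induction s using Finset.induction_on generalizing m with
  | empty => cases m <;> simp [Polynomial.coeff_one]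
  | insert j s hj ih =>
    specialize ih (fun l hl => ha l (Finset.mem_insert_of_mem hl))
      (fun l hl => hy l (Finset.mem_insert_of_mem hl))
    have haj := ha j (Finset.mem_insert_self j s)
    have hyj := hy j (Finset.mem_insert_self j s)
    have hc : 0 ≤ c := (abs_nonneg _).trans haj
    rw [Finset.prod_insert hj, Finset.card_insert_of_notMem hj, mul_assoc,
      Polynomial.coeff_C_mul, abs_mul, pow_succ', mul_assoc]
    refine mul_le_mul haj ?_ (abs_nonneg _) hc
    have hmul (l : ℕ) (q : Polynomial ℝ) : |y j * q.coeff l| ≤ |q.coeff l| := by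
      rw [abs_mul]
      exact mul_le_of_le_one_left (abs_nonneg _) hyj
    cases m with
    | zero =>
      rw [sub_mul, Polynomial.coeff_sub, Polynomial.coeff_X_mul_zero, Polynomial.coeff_C_mul,
        zero_sub, abs_neg]
      simpa using (hmul 0 _).trans (ih 0)
    | succ m =>
      rw [sub_mul, Polynomial.coeff_sub, Polynomial.coeff_X_mul, Polynomial.coeff_C_mul,
        Nat.choose_succ_succ, Nat.cast_add, mul_add]
      exact (abs_sub _ _).trans (add_le_add (ih m) ((hmul (m + 1) _).trans (ih (m + 1))))

/-- For `k ≥ 2`, `ζ > 0`, and a `ζ`-separated vector `v ∈ [0,1]ᵏ`, the coefficient norm of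
each Lagrange interpolation polynomial `p_{v,i}` satisfies
`‖p_{v,i}‖_c ≤ (k−1)·(2/ζ)^(k−1)`. -/
theorem stmt4 {k : ℕ} (hk : 2 ≤ k) (ζ : ℝ) (hζ : 0 < ζ) (v : Fin k → ℝ)
    (hmem : ∀ j, v j ∈ Set.Icc (0 : ℝ) 1)
    (hsep : ∀ i j, i ≠ j → ζ ≤ |v i - v j|) (i : Fin k) :
    coeffNorm k (Lagrange.basis Finset.univ v i) ≤ ((k : ℝ) - 1) * (2 / ζ) ^ (k - 1) := by
  have hcoeff (m : ℕ) : |(Lagrange.basis Finset.univ v i).coeff m| ≤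
      ζ⁻¹ ^ (k - 1) * ((k - 1).choose m : ℝ) := by
    have h := abs_coeff_prod_linear_le (Finset.univ.erase i) (fun j => (v i - v j)⁻¹) v ζ⁻¹
      (fun j hj => by
        rw [abs_inv]
        exact inv_anti₀ hζ (hsep i j (Finset.ne_of_mem_erase hj).symm))
      (fun j _ => abs_le.2 ⟨by linarith [(hmem j).1], (hmem j).2⟩) m
    simpa [Lagrange.basis, Lagrange.basisDivisor] using h
  have hchoose : ∑ j ∈ Finset.range k, ((k - 1).choose j : ℝ) = 2 ^ (k - 1) := by
    have h := Nat.sum_range_choose (k - 1)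
    rw [Nat.sub_add_cancel (by omega)] at h
    exact_mod_cast h
  calc coeffNorm k (Lagrange.basis Finset.univ v i)
      ≤ ∑ j ∈ Finset.range k, ((k : ℝ) - 1) * (ζ⁻¹ ^ (k - 1) * ((k - 1).choose j : ℝ)) := by
        refine Finset.sum_le_sum fun j hj => ?_
        have hjk : (j : ℝ) + 1 ≤ k := by exact_mod_cast Finset.mem_range.1 hj
        have hj0 : (0 : ℝ) ≤ j := j.cast_nonneg
        exact mul_le_mul (by linarith) (hcoeff j) (abs_nonneg _) (by linarith)
    _ = ((k : ℝ) - 1) * (2 / ζ) ^ (k - 1) := by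
        rw [← Finset.mul_sum, ← Finset.mul_sum, hchoose, ← mul_pow, inv_mul_eq_div]
end

section
/- Let k ≥ 2, ζ > 0, and let m_1,…,m_{k−1} ∈ [0,1]^k each be ζ-separated. Then for every unit vector z ∈ ℝ^k there exist real coefficients (λ_R)_{R ⊆ [k−1]} with |λ_R| ≤ β^{−k} for every R, such that z = ∑_{R ⊆ [k−1]} λ_R · m_R. -/
/-- `β = (ζ/2)^(k−1) / (3k³)`. -/
noncomputable def beta (k : ℕ) (ζ : ℝ) : ℝ := (ζ / 2) ^ (k - 1) / (3 * (k : ℝ) ^ 3)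

/-- For `R ⊆ [k−1]`, the Hadamard product `m_R = ⊙_{i∈R} m_i` (with `m_∅ = 𝟙`),
as a vector in Euclidean space. -/
noncomputable def hadProd {k : ℕ} (m : Fin (k - 1) → Fin k → ℝ)
    (R : Finset (Fin (k - 1))) : EuclideanSpace ℝ (Fin k) :=
  (WithLp.equiv 2 (Fin k → ℝ)).symm (fun j => ∏ i ∈ R, m i j)

/-- If each of `m_1, …, m_{k−1}` is `ζ`-separated with entries in `[0,1]`, every standard basis
vector is a combination of the Hadamard products with coefficients at most `ζ^{-(k-1)}`. -/
lemma exists_coeff_single {k : ℕ} {ζ : ℝ} (hζ : 0 < ζ)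
    (m : Fin (k - 1) → Fin k → ℝ)
    (hmem : ∀ i j, m i j ∈ Set.Icc (0 : ℝ) 1)
    (hsep : ∀ i, ∀ a b, a ≠ b → ζ ≤ |m i a - m i b|) (j : Fin k) :
    ∃ c : Finset (Fin (k - 1)) → ℝ, (∀ R, |c R| ≤ ζ⁻¹ ^ (k - 1)) ∧
      ∀ a, ∑ R, c R * ∏ i ∈ R, m i a = if a = j then 1 else 0 := by
  have hcard : Fintype.card (Fin (k - 1)) = Fintype.card {a : Fin k // a ≠ j} := by simp
  let σ := Fintype.equivOfCardEq hcard
  let d : Fin (k - 1) → ℝ := fun i => (m i j - m i (σ i))⁻¹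
  have hgap : ∀ i, ζ ≤ |m i j - m i (σ i)| := fun i => hsep i _ _ (σ i).2.symm
  have hne : ∀ i, m i j - m i (σ i) ≠ 0 := fun i => abs_pos.mp (hζ.trans_le (hgap i))
  have hd : ∀ i, |d i| ≤ ζ⁻¹ := fun i => by
    rw [abs_inv]
    exact inv_anti₀ hζ (hgap i)
  have hd' : ∀ i, |-(d i * m i (σ i))| ≤ ζ⁻¹ := fun i => by
    rw [abs_neg, abs_mul, abs_of_nonneg (hmem i (σ i)).1]
    exact (mul_le_of_le_one_right (abs_nonneg _) (hmem i (σ i)).2).trans (hd i)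
  refine ⟨fun R => (∏ i ∈ R, d i) * ∏ i ∈ Finset.univ \ R, -(d i * m i (σ i)), fun R => ?_,
    fun a => ?_⟩
  · rw [abs_mul, Finset.abs_prod, Finset.abs_prod]
    calc
      _ ≤ (∏ _i ∈ R, ζ⁻¹) * ∏ _i ∈ Finset.univ \ R, ζ⁻¹ := by
        gcongr
        · exact hd _
        · exact hd' _
      _ = ζ⁻¹ ^ (k - 1) := by
        rw [mul_comm, Finset.prod_sdiff (Finset.subset_univ R)]
        simp
  · have hexp : ∑ R, ((∏ i ∈ R, d i) * ∏ i ∈ Finset.univ \ R, -(d i * m i (σ i))) *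
        ∏ i ∈ R, m i a = ∏ i, (d i * m i a + -(d i * m i (σ i))) := by
      rw [Finset.prod_add, Finset.powerset_univ]
      refine Finset.sum_congr rfl fun R _ => ?_
      rw [Finset.prod_mul_distrib]
      ring
    rw [hexp]
    split_ifs with h
    · subst h
      refine Finset.prod_eq_one fun i _ => ?_
      rw [← sub_eq_add_neg, ← mul_sub]
      exact inv_mul_cancel₀ (hne i)
    · refine Finset.prod_eq_zero (Finset.mem_univ (σ.symm ⟨a, h⟩)) ?_
      simp

/-- For `ζ ≤ 1`, the quantity `k ζ^{-(k-1)}` is at most `β^{-k}`. -/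
lemma mul_inv_pow_le_beta_inv_pow {k : ℕ} (hk : 1 ≤ k) {ζ : ℝ} (hζ : 0 < ζ) (hζ1 : ζ ≤ 1) :
    (k : ℝ) * ζ⁻¹ ^ (k - 1) ≤ (beta k ζ)⁻¹ ^ k := by
  have hk' : (1 : ℝ) ≤ k := by exact_mod_cast hk
  have hpow : (1 : ℝ) ≤ ζ⁻¹ ^ (k - 1) := one_le_pow₀ ((one_le_inv₀ hζ).2 hζ1)
  have hle : (k : ℝ) * ζ⁻¹ ^ (k - 1) ≤ (beta k ζ)⁻¹ := by
    rw [beta, inv_div, div_eq_mul_inv, ← inv_pow]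
    gcongr
    · nlinarith [le_self_pow₀ hk' three_ne_zero]
    · linarith
  exact hle.trans (le_self_pow₀ ((one_le_mul_of_one_le_of_one_le hk' hpow).trans hle) (by omega))


/-- Let `k ≥ 2`, `ζ > 0`, and let `m_1, …, m_{k−1} ∈ [0,1]ᵏ` each be `ζ`-separated. Then
every unit vector `z ∈ ℝᵏ` is a linear combination `z = ∑_{R ⊆ [k−1]} λ_R m_R` of the
Hadamard products `m_R`, with all coefficients bounded by `|λ_R| ≤ β⁻ᵏ`. -/
theorem stmt6 {k : ℕ} (hk : 2 ≤ k) (ζ : ℝ) (hζ : 0 < ζ)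
    (m : Fin (k - 1) → Fin k → ℝ)
    (hmem : ∀ i j, m i j ∈ Set.Icc (0 : ℝ) 1)
    (hsep : ∀ i, ∀ a b, a ≠ b → ζ ≤ |m i a - m i b|)
    (z : EuclideanSpace ℝ (Fin k)) (hz : ‖z‖ = 1) :
    ∃ lam : Finset (Fin (k - 1)) → ℝ,
      (∀ R, |lam R| ≤ (beta k ζ)⁻¹ ^ k) ∧
      z = ∑ R : Finset (Fin (k - 1)), lam R • hadProd m R := by
  have hζ1 : ζ ≤ 1 := by
    let i : Fin (k - 1) := ⟨0, by omega⟩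
    have h := hsep i ⟨0, by omega⟩ ⟨1, by omega⟩ (by simp)
    refine h.trans (abs_sub_le_iff.2 ⟨?_, ?_⟩)
    · linarith [(hmem i ⟨0, by omega⟩).2, (hmem i ⟨1, by omega⟩).1]
    · linarith [(hmem i ⟨0, by omega⟩).1, (hmem i ⟨1, by omega⟩).2]
  choose c hc hcsum using exists_coeff_single hζ m hmem hsep
  refine ⟨fun R => ∑ j, z j * c j R, fun R => ?_, ?_⟩
  · refine le_trans ?_ (mul_inv_pow_le_beta_inv_pow (by omega) hζ hζ1)
    calc
      |∑ j, z j * c j R| ≤ ∑ j, |z j * c j R| := Finset.abs_sum_le_sum_abs _ _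
      _ ≤ ∑ _j : Fin k, ζ⁻¹ ^ (k - 1) := by
        refine Finset.sum_le_sum fun j _ => ?_
        have hzj : |z j| ≤ 1 := hz ▸ PiLp.norm_apply_le z j
        rw [abs_mul]
        exact (mul_le_of_le_one_left (abs_nonneg _) hzj).trans (hc j R)
      _ = k * ζ⁻¹ ^ (k - 1) := by simp
  · ext a
    simp only [hadProd, WithLp.equiv_symm_apply, WithLp.ofLp_sum, WithLp.ofLp_smul,
      Finset.sum_apply, Pi.smul_apply, smul_eq_mul, Finset.sum_mul, mul_assoc]
    rw [Finset.sum_comm]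
    simp only [← Finset.mul_sum, hcsum]
    simp
end

section
/- Let k ≥ 2, ζ > 0, and let m_1,…,m_{k−1} ∈ [0,1]^k each be ζ-separated. Then the 2^{k−1} × k matrix M[2^S] with rows m_R, R ⊆ [k−1], satisfies σ_max(M[2^S]) ≤ k·2^{k−1} and σ_k(M[2^S]) ≥ β^k · 2^{−k}/k. -/
open Matrix

/-- The continuous linear map on Euclidean spaces associated with a real matrix. -/
noncomputable def matCLM {m n : Type*} [Fintype m] [Fintype n] [DecidableEq n]
    (A : Matrix m n ℝ) : EuclideanSpace ℝ n →L[ℝ] EuclideanSpace ℝ m :=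
  LinearMap.toContinuousLinearMap (Matrix.toEuclideanLin A)

/-- The largest singular value of `A`: the supremum of `‖A z‖` over unit vectors `z`. -/
noncomputable def sigmaMax {m n : Type*} [Fintype m] [Fintype n] [DecidableEq n]
    (A : Matrix m n ℝ) : ℝ :=
  sSup {t : ℝ | ∃ z : EuclideanSpace ℝ n, ‖z‖ = 1 ∧ t = ‖matCLM A z‖}

/-- The smallest singular value of a matrix `A` with at least as many rows as columns:
the infimum of `‖A z‖` over unit vectors `z`. -/
noncomputable def sigmaMin {m n : Type*} [Fintype m] [Fintype n] [DecidableEq n]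
    (A : Matrix m n ℝ) : ℝ :=
  sInf {t : ℝ | ∃ z : EuclideanSpace ℝ n, ‖z‖ = 1 ∧ t = ‖matCLM A z‖}

/-- Entries of the image of a vector under `matCLM A`. -/
lemma matCLM_apply {m n : Type*} [Fintype m] [Fintype n] [DecidableEq n]
    (A : Matrix m n ℝ) (z : EuclideanSpace ℝ n) (i : m) :
    matCLM A z i = ∑ j, A i j * z j := by
  simp [matCLM, Matrix.toLpLin_apply, Matrix.mulVec, dotProduct]

/-- A coordinate of a Euclidean vector is bounded by its norm. -/
lemma abs_coord_le_norm {n : Type*} [Fintype n] (z : EuclideanSpace ℝ n) (i : n) :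
    |z i| ≤ ‖z‖ := by
  simpa using PiLp.norm_apply_le z i

/-- The Euclidean norm is bounded by the sum of the absolute values of the coordinates. -/
lemma norm_le_sum_abs_coord {n : Type*} [Fintype n] (z : EuclideanSpace ℝ n) :
    ‖z‖ ≤ ∑ i, |z i| := by
  rw [EuclideanSpace.norm_eq]
  apply Real.sqrt_le_iff.2
  refine ⟨Finset.sum_nonneg fun i _ => abs_nonneg _, ?_⟩
  simpa using Finset.sum_sq_le_sq_sum_of_nonneg (s := Finset.univ) (f := fun i => |z i|)
    fun i _ => abs_nonneg _

/-- A matrix with entries in `[-1, 1]` has largest singular value at most the product of its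
dimensions. -/
lemma sigmaMax_le_card_mul_card {m n : Type*} [Fintype m] [Fintype n] [DecidableEq n]
    (A : Matrix m n ℝ) (hA : ∀ i j, |A i j| ≤ 1) :
    sigmaMax A ≤ (Fintype.card n : ℝ) * Fintype.card m := by
  apply Real.sSup_le _ (by positivity)
  rintro _ ⟨z, hz, rfl⟩
  have hrow : ∀ i, |matCLM A z i| ≤ Fintype.card n := fun i => by
    rw [matCLM_apply]
    calc |∑ j, A i j * z j| ≤ ∑ j, |A i j * z j| := Finset.abs_sum_le_sum_abs _ _
      _ ≤ ∑ _j : n, (1 : ℝ) := Finset.sum_le_sum fun j _ => by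
          rw [abs_mul]
          exact mul_le_one₀ (hA i j) (abs_nonneg _) (hz ▸ abs_coord_le_norm z j)
      _ = Fintype.card n := by simp
  calc ‖matCLM A z‖ ≤ ∑ i, |matCLM A z i| := norm_le_sum_abs_coord _
    _ ≤ ∑ _i : m, (Fintype.card n : ℝ) := Finset.sum_le_sum fun i _ => hrow i
    _ = (Fintype.card n : ℝ) * Fintype.card m := by simp [mul_comm]

/-- If every coordinate functional, scaled to have size at least `δ`, is a combination of the rows
of `A` with coefficients in `[-1, 1]`, then the smallest singular value of `A` is at least `δ`
divided by the product of the dimensions. -/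
lemma div_card_le_sigmaMin {m n : Type*} [Fintype m] [Fintype n] [DecidableEq n] [Nonempty n]
    [Nonempty m] (A : Matrix m n ℝ) {δ : ℝ}
    (hA : ∀ j, ∃ c : m → ℝ, (∀ i, |c i| ≤ 1) ∧ (∀ l ≠ j, ∑ i, c i * A i l = 0) ∧
      δ ≤ |∑ i, c i * A i j|) :
    δ / Fintype.card m / Fintype.card n ≤ sigmaMin A := by
  have hn : (0 : ℝ) < Fintype.card n := by exact_mod_cast Fintype.card_pos
  have hm : (0 : ℝ) < Fintype.card m := by exact_mod_cast Fintype.card_pos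
  apply le_csInf
  · exact ⟨_, EuclideanSpace.single (Classical.arbitrary n) 1, by simp, rfl⟩
  rintro _ ⟨z, hz, rfl⟩
  obtain ⟨j, -, hj⟩ := Finset.exists_le_of_sum_le (s := (Finset.univ : Finset n))
    (f := fun _ => 1 / (Fintype.card n : ℝ)) (g := fun j => |z j|) Finset.univ_nonempty (by
      simpa [hn.ne', hz] using norm_le_sum_abs_coord z)
  obtain ⟨c, hc, hzero, hdiag⟩ := hA j
  have hcomb : ∑ i, c i * matCLM A z i = (∑ i, c i * A i j) * z j := by
    simp_rw [matCLM_apply, Finset.mul_sum, ← mul_assoc]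
    rw [Finset.sum_comm]
    simp_rw [← Finset.sum_mul]
    exact Finset.sum_eq_single j (fun l _ hl => by rw [hzero l hl, zero_mul]) (by simp)
  have hlower : δ * (1 / Fintype.card n) ≤ |∑ i, c i * matCLM A z i| := by
    rw [hcomb, abs_mul]
    gcongr
  have hupper : |∑ i, c i * matCLM A z i| ≤ Fintype.card m * ‖matCLM A z‖ :=
    calc |∑ i, c i * matCLM A z i| ≤ ∑ i, |c i * matCLM A z i| := Finset.abs_sum_le_sum_abs _ _
      _ ≤ ∑ _i : m, ‖matCLM A z‖ := Finset.sum_le_sum fun i _ => by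
          rw [abs_mul]
          calc |c i| * |matCLM A z i| ≤ 1 * ‖matCLM A z‖ := by
                gcongr
                · exact hc i
                · exact abs_coord_le_norm _ i
            _ = ‖matCLM A z‖ := one_mul _
      _ = Fintype.card m * ‖matCLM A z‖ := by simp
  rw [div_div, div_le_iff₀ (by positivity)]
  have h := hlower.trans hupper
  rw [mul_one_div, div_le_iff₀ hn] at h
  linarith

/-- For each point `j`, a combination of the subset products with coefficients in `[-1, 1]`
vanishes off `j` and has size at least `ζ ^ n` at `j`. -/
lemma exists_coeff_subset_prod {n : ℕ} {ζ : ℝ} (hζ : 0 < ζ) (m : Fin n → Fin (n + 1) → ℝ)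
    (hmem : ∀ i j, m i j ∈ Set.Icc (0 : ℝ) 1)
    (hsep : ∀ i, ∀ a b, a ≠ b → ζ ≤ |m i a - m i b|) (j : Fin (n + 1)) :
    ∃ c : Finset (Fin n) → ℝ, (∀ R, |c R| ≤ 1) ∧
      (∀ l ≠ j, ∑ R, c R * ∏ i ∈ R, m i l = 0) ∧ ζ ^ n ≤ |∑ R, c R * ∏ i ∈ R, m i j| := by
  have hexp : ∀ l, ∑ R : Finset (Fin n),
      (∏ i ∈ Finset.univ \ R, -m i (j.succAbove i)) * ∏ i ∈ R, m i l =
        ∏ i, (m i l - m i (j.succAbove i)) := fun l => by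
    simp_rw [sub_eq_add_neg, Finset.prod_add, Finset.powerset_univ, mul_comm]
  refine ⟨fun R => ∏ i ∈ Finset.univ \ R, -m i (j.succAbove i), fun R => ?_, fun l hl => ?_, ?_⟩
  · rw [Finset.abs_prod]
    refine Finset.prod_le_one (fun _ _ => abs_nonneg _) fun i _ => ?_
    rw [abs_neg, abs_of_nonneg (hmem _ _).1]
    exact (hmem _ _).2
  · obtain ⟨i, rfl⟩ := Fin.exists_succAbove_eq hl
    rw [hexp]
    exact Finset.prod_eq_zero (Finset.mem_univ i) (sub_self _)
  · rw [hexp, Finset.abs_prod]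
    calc ζ ^ n = ∏ _i : Fin n, ζ := by simp
      _ ≤ _ := Finset.prod_le_prod (fun _ _ => hζ.le) fun i _ =>
          hsep i _ _ (Fin.succAbove_ne j i).symm

lemma beta_pow_le {k : ℕ} (hk : k ≠ 0) {ζ : ℝ} (hζ : 0 ≤ ζ) (hζ1 : ζ ≤ 1) :
    beta k ζ ^ k ≤ ζ ^ (k - 1) := by
  have hk1 : (1 : ℝ) ≤ k := by exact_mod_cast Nat.one_le_iff_ne_zero.2 hk
  have hle : beta k ζ ≤ ζ ^ (k - 1) := by
    unfold beta
    have h3 : (1 : ℝ) ≤ 3 * (k : ℝ) ^ 3 := by linarith [one_le_pow₀ hk1 (n := 3)]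
    refine (div_le_self (by positivity) h3).trans ?_
    gcongr
    linarith
  have h0 : 0 ≤ beta k ζ := by unfold beta; positivity
  exact (pow_le_of_le_one h0 (hle.trans (pow_le_one₀ hζ hζ1)) hk).trans hle

/-- Let `k ≥ 2`, `ζ > 0`, and let `m_1, …, m_{k−1} ∈ [0,1]ᵏ` each be `ζ`-separated. Then
the `2^(k−1) × k` matrix `M[2^S]` whose rows are the Hadamard products `m_R`, `R ⊆ [k−1]`,
satisfies `σ_max(M[2^S]) ≤ k·2^(k−1)` and `σ_k(M[2^S]) ≥ βᵏ·2⁻ᵏ/k`. -/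
theorem stmt8 {k : ℕ} (hk : 2 ≤ k) (ζ : ℝ) (hζ : 0 < ζ)
    (m : Fin (k - 1) → Fin k → ℝ)
    (hmem : ∀ i j, m i j ∈ Set.Icc (0 : ℝ) 1)
    (hsep : ∀ i, ∀ a b, a ≠ b → ζ ≤ |m i a - m i b|) :
    sigmaMax (Matrix.of fun (R : Finset (Fin (k - 1))) (j : Fin k) => ∏ i ∈ R, m i j) ≤
        (k : ℝ) * 2 ^ (k - 1) ∧
      beta k ζ ^ k / 2 ^ k / (k : ℝ) ≤
        sigmaMin (Matrix.of fun (R : Finset (Fin (k - 1))) (j : Fin k) => ∏ i ∈ R, m i j) := by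
  obtain ⟨n, rfl⟩ : ∃ n, k = n + 1 := ⟨k - 1, by omega⟩
  constructor
  · refine (sigmaMax_le_card_mul_card _ fun R j => ?_).trans (by simp)
    rw [Matrix.of_apply, Finset.abs_prod]
    refine Finset.prod_le_one (fun _ _ => abs_nonneg _) fun i _ => ?_
    rw [abs_of_nonneg (hmem i j).1]
    exact (hmem i j).2
  · have hζ1 : ζ ≤ 1 := by
      let i : Fin (n + 1 - 1) := ⟨0, by omega⟩
      have h01 : (0 : Fin (n + 1)) ≠ Fin.last n := by
        rw [Ne, Fin.ext_iff, Fin.val_zero, Fin.val_last]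
        omega
      refine (hsep i _ _ h01).trans (abs_le.2 ⟨?_, ?_⟩) <;>
        linarith [(hmem i 0).1, (hmem i 0).2, (hmem i (Fin.last n)).1, (hmem i (Fin.last n)).2]
    refine le_trans ?_ (div_card_le_sigmaMin _ fun j => by
      simpa using exists_coeff_subset_prod hζ m hmem hsep j)
    rw [Fintype.card_finset, Fintype.card_fin, Fintype.card_fin]
    push_cast
    gcongr
    · exact beta_pow_le n.succ_ne_zero hζ.le hζ1
    · norm_num
    · omega
end

section
/- Let A ∈ ℝ^{k×n} with k < n, and suppose σ_k(A) ≥ ε > 0. Then there exists a subset J ⊆ [n] of the columns with |J| = k such that the k×k submatrix A_J formed by the columns in J satisfies σ_k(A_J) ≥ ε / √(k(n−k) + 1). -/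
open Matrix

lemma norm_matCLM_sq {m n : Type*} [Fintype m] [Fintype n] [DecidableEq n]
    (A : Matrix m n ℝ) (z : EuclideanSpace ℝ n) :
    ‖matCLM A z‖ ^ 2 = ∑ i, (A *ᵥ z.ofLp) i ^ 2 := by
  simp [EuclideanSpace.norm_sq_eq, matCLM, Matrix.toLpLin_apply]

lemma sigmaMin_le_norm {m n : Type*} [Fintype m] [Fintype n] [DecidableEq n]
    (A : Matrix m n ℝ) {z : EuclideanSpace ℝ n} (hz : ‖z‖ = 1) :
    sigmaMin A ≤ ‖matCLM A z‖ :=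
  csInf_le ⟨0, by rintro _ ⟨z, -, rfl⟩; exact norm_nonneg _⟩ ⟨z, hz, rfl⟩

lemma mulVec_injective_of_sigmaMin_pos {m n : Type*} [Fintype m] [Fintype n] [DecidableEq n]
    {A : Matrix m n ℝ} (hA : 0 < sigmaMin A) : Function.Injective A.mulVec := by
  rw [← Matrix.coe_mulVecLin, ← LinearMap.ker_eq_bot, LinearMap.ker_eq_bot']
  intro v hv
  by_contra hne
  have hz : WithLp.toLp 2 v ≠ 0 := fun h => hne (by simpa using h)
  have h := sigmaMin_le_norm A (norm_smul_inv_norm (𝕜 := ℝ) hz)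
  rw [map_smul] at h
  have h0 : matCLM A (WithLp.toLp 2 v) = 0 := by
    rw [← norm_eq_zero, ← sq_eq_zero_iff, norm_matCLM_sq]
    simp only [Matrix.mulVecLin_apply] at hv
    simp [hv]
  rw [h0, smul_zero, norm_zero] at h
  exact absurd hA h.not_gt

lemma exists_det_submatrix_ne_zero {k : ℕ} {n : Type*} [Fintype n] {A : Matrix (Fin k) n ℝ}
    (hA : Function.Injective Aᵀ.mulVec) :
    ∃ f : Fin k → n, (A.submatrix id f).det ≠ 0 := by
  have hrank : Module.finrank ℝ (Submodule.span ℝ (Set.range A.col)) = k := by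
    rw [← Matrix.rank_eq_finrank_span_cols]
    simpa using (Matrix.mulVec_injective_iff.mp hA).rank_matrix
  have hbasis := Submodule.exists_fun_fin_finrank_span_eq ℝ (Set.range A.col)
  rw [hrank] at hbasis
  obtain ⟨g, hg, -, hli⟩ := hbasis
  choose f hf using hg
  refine ⟨f, ?_⟩
  rw [← Matrix.det_transpose, ← isUnit_iff_ne_zero, ← Matrix.isUnit_iff_isUnit_det,
    ← Matrix.linearIndependent_rows_iff_isUnit,
    show (A.submatrix id f)ᵀ.row = g from funext hf]
  exact hli

/-- If the columns selected by `f` maximize the absolute value of the determinant, then by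
Cramer's rule every column is a combination of them with coefficients of size at most `1`. -/
lemma sq_transpose_mulVec_le {k n : Type*} [Fintype k] [DecidableEq k]
    {A : Matrix k n ℝ} {f : k → n} (hdet : (A.submatrix id f).det ≠ 0)
    (hmax : ∀ g : k → n, |(A.submatrix id g).det| ≤ |(A.submatrix id f).det|)
    (z : k → ℝ) (j : n) :
    (Aᵀ *ᵥ z) j ^ 2 ≤ Fintype.card k * ∑ i, ((A.submatrix id f)ᵀ *ᵥ z) i ^ 2 := by
  set B := A.submatrix id f
  set d := B.cramer (A.col j) with hd
  have hcoeff (i : k) : d i ^ 2 ≤ B.det ^ 2 := by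
    have : B.updateCol i (A.col j) = A.submatrix id (Function.update f i j) := by
      ext a b
      rcases eq_or_ne b i with rfl | hb
      · simp
      · simp [B, hb]
    rw [hd, Matrix.cramer_apply, this]
    exact sq_le_sq.mpr (hmax _)
  have hcramer : B.det * (Aᵀ *ᵥ z) j = ∑ i, d i * (Bᵀ *ᵥ z) i := by
    have h := congrArg (· ⬝ᵥ z) (Matrix.mulVec_cramer B (A.col j))
    rw [smul_dotProduct, ← Matrix.vecMul_transpose, ← Matrix.dotProduct_mulVec] at h
    exact h.symm
  have hsum : ∑ i, d i ^ 2 ≤ Fintype.card k * B.det ^ 2 := by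
    simpa using Finset.sum_le_sum fun i (_ : i ∈ Finset.univ) => hcoeff i
  refine le_of_mul_le_mul_left ?_ (sq_pos_of_ne_zero hdet)
  calc B.det ^ 2 * (Aᵀ *ᵥ z) j ^ 2 = (∑ i, d i * (Bᵀ *ᵥ z) i) ^ 2 := by rw [← hcramer]; ring
    _ ≤ (∑ i, d i ^ 2) * ∑ i, (Bᵀ *ᵥ z) i ^ 2 := Finset.sum_mul_sq_le_sq_mul_sq _ _ _
    _ ≤ (Fintype.card k * B.det ^ 2) * ∑ i, (Bᵀ *ᵥ z) i ^ 2 := by gcongr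
    _ = _ := by ring

/-- (Corollary 6 in Feldman–O'Donnell–Servedio.) Let `A ∈ ℝ^{k×n}` with `k < n` and
`σ_k(A) ≥ ε > 0` (the `k`-th singular value of `A`, i.e. the smallest singular value of
`Aᵀ`). Then some `k` columns of `A` form a `k × k` submatrix `A_J` with
`σ_k(A_J) ≥ ε / √(k(n−k) + 1)`. -/
theorem stmt9 {k n : ℕ} (hkn : k < n) (A : Matrix (Fin k) (Fin n) ℝ)
    (ε : ℝ) (hε : 0 < ε) (hσ : ε ≤ sigmaMin Aᵀ) :
    ∃ f : Fin k → Fin n, Function.Injective f ∧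
      ε / Real.sqrt ((k : ℝ) * ((n : ℝ) - (k : ℝ)) + 1) ≤
        sigmaMin (A.submatrix id f)ᵀ := by
  have hinj := mulVec_injective_of_sigmaMin_pos (hε.trans_le hσ)
  obtain ⟨f₀, hf₀⟩ := exists_det_submatrix_ne_zero hinj
  have : Nonempty (Fin k → Fin n) := ⟨f₀⟩
  obtain ⟨f, hmax⟩ := Finite.exists_max fun g : Fin k → Fin n => |(A.submatrix id g).det|
  have hdet : (A.submatrix id f).det ≠ 0 :=
    abs_pos.mp ((abs_pos.mpr hf₀).trans_le (hmax f₀))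
  have hf : Function.Injective f := fun a b hab => by
    by_contra hne
    exact hdet (Matrix.det_zero_of_column_eq hne fun i => by simp [hab])
  refine ⟨f, hf, ?_⟩
  have hk : 0 < k := by
    rcases k.eq_zero_or_pos with rfl | hk
    · refine absurd (hε.trans_le hσ) (not_lt.mpr (Real.sInf_nonpos ?_))
      rintro _ ⟨z, hz, -⟩
      simp [Subsingleton.elim z 0] at hz
    · exact hk
  refine le_csInf ⟨_, EuclideanSpace.single ⟨0, hk⟩ 1, by simp, rfl⟩ ?_
  rintro _ ⟨z, hz, rfl⟩
  have hC : (0 : ℝ) < k * ((n : ℝ) - k) + 1 := by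
    have : (k : ℝ) ≤ n := by exact_mod_cast hkn.le
    have := mul_nonneg (Nat.cast_nonneg (α := ℝ) k) (sub_nonneg.mpr this)
    linarith
  rw [div_le_iff₀ (Real.sqrt_pos.mpr hC)]
  refine (hσ.trans (sigmaMin_le_norm Aᵀ hz)).trans ?_
  refine le_of_sq_le_sq ?_ (by positivity)
  rw [mul_pow, Real.sq_sqrt hC.le, norm_matCLM_sq, norm_matCLM_sq,
    ← Finset.sum_add_sum_compl (Finset.univ.image f),
    Finset.sum_image fun _ _ _ _ h => hf h]
  have hcard : ((Finset.univ.image f)ᶜ.card : ℝ) = n - k := by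
    rw [Finset.card_compl, Finset.card_image_of_injective _ hf]
    simp [Nat.cast_sub hkn.le]
  have hcompl := Finset.sum_le_card_nsmul (Finset.univ.image f)ᶜ _ _
    fun j _ => sq_transpose_mulVec_le hdet hmax z.ofLp j
  rw [nsmul_eq_mul, hcard, Fintype.card_fin] at hcompl
  have himage : ∑ i, (Aᵀ *ᵥ z.ofLp) (f i) ^ 2 =
      ∑ i, ((A.submatrix id f)ᵀ *ᵥ z.ofLp) i ^ 2 := rfl
  rw [himage]
  linarith
end

section
/- Let ζ > 0 and let m ∈ [0,1]^k be ζ-separated. Let V ∈ ℝ^{k×k} be the Vandermonde matrix whose rows are the Hadamard powers m^{⊙i} for i = 0,1,…,k−1 (i.e., V_{i+1,j} = m_j^i). Then V is invertible and ‖V^{−1}‖ ≤ 2^k / ζ^{k−1}. -/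
open Matrix

/-- The operator norm of a matrix with respect to Euclidean norms. -/
noncomputable def opNorm {m n : Type*} [Fintype m] [Fintype n] [DecidableEq n]
    (A : Matrix m n ℝ) : ℝ :=
  ‖matCLM A‖

open Polynomial in
theorem sum_abs_coeff_prod_X_sub_C_le {ι : Type*} (s : Finset ι) (v : ι → ℝ)
    (hv : ∀ i ∈ s, |v i| ≤ 1) (N : ℕ) :
    ∑ i ∈ Finset.range N, |(∏ j ∈ s, (X - C (v j))).coeff i| ≤ 2 ^ s.card := by
  classical
  induction s using Finset.induction_on generalizing N with
  | empty =>
    rcases N with _ | N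
    · simp
    · simp [Finset.sum_range_succ', coeff_one]
  | insert a s ha ih =>
    have hvs : ∀ i ∈ s, |v i| ≤ 1 := fun i hi => hv i (Finset.mem_insert_of_mem hi)
    have hva : |v a| ≤ 1 := hv a (Finset.mem_insert_self a s)
    rw [Finset.prod_insert ha, Finset.card_insert_of_notMem ha, pow_succ]
    set p := ∏ j ∈ s, (X - C (v j))
    have hmul : ∀ i, |v a * p.coeff i| ≤ |p.coeff i| := fun i => by
      rw [abs_mul]
      exact mul_le_of_le_one_left (abs_nonneg _) hva
    have hsub : ∑ i ∈ Finset.range N, |((X - C (v a)) * p).coeff i| ≤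
        ∑ i ∈ Finset.range N, |(X * p).coeff i| + ∑ i ∈ Finset.range N, |p.coeff i| := by
      rw [← Finset.sum_add_distrib]
      refine Finset.sum_le_sum fun i _ => ?_
      rw [sub_mul, coeff_sub, coeff_C_mul]
      exact (abs_sub _ _).trans (add_le_add le_rfl (hmul i))
    have hshift : ∑ i ∈ Finset.range N, |(X * p).coeff i| ≤ 2 ^ s.card := by
      rcases N with _ | N
      · simp
      · rw [Finset.sum_range_succ']
        simpa using ih hvs N
    linarith [ih hvs N]

theorem opNorm_le_of_sum_sq_le {m n : Type*} [Fintype m] [Fintype n] [DecidableEq n]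
    (A : Matrix m n ℝ) {B : ℝ} (hB : 0 ≤ B) (h : ∑ i, ∑ j, A i j ^ 2 ≤ B ^ 2) :
    opNorm A ≤ B := by
  refine ContinuousLinearMap.opNorm_le_bound _ hB fun x => ?_
  refine le_of_sq_le_sq ?_ (by positivity)
  rw [mul_pow, EuclideanSpace.real_norm_sq_eq, EuclideanSpace.real_norm_sq_eq]
  calc ∑ i, (matCLM A x) i ^ 2 = ∑ i, (∑ j, A i j * x j) ^ 2 := rfl
    _ ≤ ∑ i, (∑ j, A i j ^ 2) * ∑ j, x j ^ 2 :=
        Finset.sum_le_sum fun i _ => Finset.sum_mul_sq_le_sq_mul_sq _ _ _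
    _ = (∑ i, ∑ j, A i j ^ 2) * ∑ j, x j ^ 2 := by rw [Finset.sum_mul]
    _ ≤ B ^ 2 * ∑ j, x j ^ 2 := by gcongr

/-- At most one point on each side of `m j` is closer to `m j` than `2 * ζ`. -/
theorem card_near_le_two {ι : Type*} [Fintype ι] [DecidableEq ι] {ζ : ℝ} {m : ι → ℝ}
    (hsep : ∀ i j, i ≠ j → ζ ≤ |m i - m j|) (j : ι) :
    ((Finset.univ.erase j).filter fun i => |m j - m i| < 2 * ζ).card ≤ 2 := by
  have hsub : ((Finset.univ.erase j).filter fun i => |m j - m i| < 2 * ζ) ⊆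
      (Finset.univ.filter fun i => ζ ≤ m j - m i ∧ m j - m i < 2 * ζ) ∪
      (Finset.univ.filter fun i => ζ ≤ m i - m j ∧ m i - m j < 2 * ζ) := by
    intro i hi
    simp only [Finset.mem_filter, Finset.mem_erase, Finset.mem_univ, and_true] at hi
    simp only [Finset.mem_union, Finset.mem_filter, Finset.mem_univ, true_and]
    have hlt := abs_lt.mp hi.2
    rcases le_abs.mp (hsep j i hi.1.symm) with h | h
    · exact Or.inl ⟨h, hlt.2⟩
    · exact Or.inr ⟨by linarith, by linarith⟩
  refine (Finset.card_le_card hsub).trans ((Finset.card_union_le _ _).trans ?_)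
  refine add_le_add (b := 1) (d := 1) ?_ ?_ <;>
  · refine Finset.card_le_one.mpr fun a ha b hb => ?_
    simp only [Finset.mem_filter, Finset.mem_univ, true_and] at ha hb
    by_contra hab
    rcases le_abs.mp (hsep a b hab) with h | h <;> linarith [ha.1, ha.2, hb.1, hb.2]

theorem pow_le_prod_abs_sub {ι : Type*} [Fintype ι] [DecidableEq ι] {ζ : ℝ} (hζ : 0 < ζ)
    {m : ι → ℝ} (hsep : ∀ i j, i ≠ j → ζ ≤ |m i - m j|) (j : ι) :
    ζ ^ (Fintype.card ι - 1) ≤ ∏ i ∈ Finset.univ.erase j, |m j - m i| := by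
  have hcard : (Finset.univ.erase j).card = Fintype.card ι - 1 := by simp
  rw [← hcard, ← Finset.prod_const]
  exact Finset.prod_le_prod (fun _ _ => hζ.le) fun i hi => hsep j i (Finset.ne_of_mem_erase hi).symm

theorem two_mul_pow_le_four_mul_prod_abs_sub {ι : Type*} [Fintype ι] [DecidableEq ι] {ζ : ℝ}
    (hζ : 0 < ζ) {m : ι → ℝ} (hsep : ∀ i j, i ≠ j → ζ ≤ |m i - m j|) (j : ι) :
    (2 * ζ) ^ (Fintype.card ι - 1) ≤ 4 * ∏ i ∈ Finset.univ.erase j, |m j - m i| := by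
  have hcard : (Finset.univ.erase j).card = Fintype.card ι - 1 := by simp
  rw [← hcard, ← Finset.prod_const]
  calc ∏ _i ∈ Finset.univ.erase j, (2 * ζ)
      ≤ ∏ i ∈ Finset.univ.erase j, ((if |m j - m i| < 2 * ζ then 2 else 1) * |m j - m i|) := by
        refine Finset.prod_le_prod (fun _ _ => by positivity) fun i hi => ?_
        have := hsep j i (Finset.ne_of_mem_erase hi).symm
        split_ifs with h <;> linarith
    _ = 2 ^ ((Finset.univ.erase j).filter fun i => |m j - m i| < 2 * ζ).card *
          ∏ i ∈ Finset.univ.erase j, |m j - m i| := by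
        rw [Finset.prod_mul_distrib, Finset.prod_ite]
        simp
    _ ≤ 2 ^ 2 * ∏ i ∈ Finset.univ.erase j, |m j - m i| := by
        gcongr
        · norm_num
        · exact card_near_le_two hsep j
    _ = _ := by norm_num

theorem card_mul_sq_le_four_mul_prod_abs_sub_sq {ι : Type*} [Fintype ι] [DecidableEq ι] {ζ : ℝ}
    (hζ : 0 < ζ) {m : ι → ℝ} (hsep : ∀ i j, i ≠ j → ζ ≤ |m i - m j|) (j : ι) :
    Fintype.card ι * (ζ ^ (Fintype.card ι - 1)) ^ 2 ≤
      4 * (∏ i ∈ Finset.univ.erase j, |m j - m i|) ^ 2 := by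
  have h1 := pow_le_prod_abs_sub hζ hsep j
  have h2 := two_mul_pow_le_four_mul_prod_abs_sub hζ hsep j
  set P := ∏ i ∈ Finset.univ.erase j, |m j - m i|
  generalize Fintype.card ι = k at h1 h2 ⊢
  rcases le_or_gt k 4 with hk | hk
  · have : (k : ℝ) ≤ 4 := by exact_mod_cast hk
    gcongr
  · obtain ⟨n, rfl⟩ : ∃ n, k = n + 2 := ⟨k - 2, by omega⟩
    have hn : n + 2 ≤ 4 ^ n := calc
      n + 2 ≤ 2 ^ (n + 1) := Nat.lt_two_pow_self (n := n + 1)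
      _ ≤ 2 ^ (2 * n) := Nat.pow_le_pow_right two_pos (by omega)
      _ = 4 ^ n := by rw [pow_mul]; norm_num
    have hn' : ((n + 2 : ℕ) : ℝ) ≤ 4 ^ n := by exact_mod_cast hn
    have hsq := pow_le_pow_left₀ (by positivity) h2 2
    have h4 : ((2 : ℝ) ^ (n + 1)) ^ 2 = 4 * 4 ^ n := by
      rw [← pow_mul, mul_comm, pow_mul]; norm_num [pow_succ, mul_comm]
    simp only [Nat.add_succ_sub_one, mul_pow _ _ (n + 1)] at hsq ⊢
    rw [mul_pow, h4, mul_pow] at hsq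
    have := mul_le_mul_of_nonneg_right hn' (sq_nonneg (ζ ^ (n + 1)))
    linarith

open Polynomial in
theorem basis_eq_C_mul_prod {F ι : Type*} [Field F] [DecidableEq ι] (s : Finset ι) (v : ι → F)
    (j : ι) : Lagrange.basis s v j =
      C (∏ i ∈ s.erase j, (v j - v i))⁻¹ * ∏ i ∈ s.erase j, (X - C (v i)) := by
  simp only [Lagrange.basis, Lagrange.basisDivisor, Finset.prod_mul_distrib]
  rw [← Finset.prod_inv_distrib, map_prod]

theorem sum_sq_coeff_basis_le {k : ℕ} {m : Fin k → ℝ} (hm : ∀ j, |m j| ≤ 1) (j : Fin k) :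
    ∑ i : Fin k, (Lagrange.basis Finset.univ m j).coeff i ^ 2 ≤
      (2 ^ (k - 1) / ∏ i ∈ Finset.univ.erase j, |m j - m i|) ^ 2 := by
  have hsum := sum_abs_coeff_prod_X_sub_C_le (Finset.univ.erase j) m (fun i _ => hm i) k
  rw [Finset.card_erase_of_mem (Finset.mem_univ j), Finset.card_univ, Fintype.card_fin] at hsum
  calc ∑ i : Fin k, (Lagrange.basis Finset.univ m j).coeff i ^ 2
      = ∑ i : Fin k, |(Lagrange.basis Finset.univ m j).coeff i| ^ 2 := by simp only [sq_abs]
    _ ≤ (∑ i : Fin k, |(Lagrange.basis Finset.univ m j).coeff i|) ^ 2 :=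
        Finset.sum_sq_le_sq_sum_of_nonneg fun _ _ => abs_nonneg _
    _ ≤ _ := by
        rw [Fin.sum_univ_eq_sum_range (fun i => |(Lagrange.basis Finset.univ m j).coeff i|) k]
        simp only [basis_eq_C_mul_prod, Polynomial.coeff_C_mul, abs_mul, abs_inv,
          Finset.abs_prod]
        rw [← Finset.mul_sum, div_eq_inv_mul]
        gcongr

/-- The inverse of the transposed Vandermonde matrix has the coefficients of the Lagrange basis
polynomials as its rows. -/
theorem coeff_basis_mul_vandermonde {F : Type*} [Field F] {k : ℕ} {m : Fin k → F}
    (hm : Function.Injective m) :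
    (Matrix.of fun j i : Fin k => (Lagrange.basis Finset.univ m j).coeff i) *
      (Matrix.of fun i j : Fin k => m j ^ (i : ℕ)) = 1 := by
  ext j l
  have hinj : Set.InjOn m (Finset.univ : Finset (Fin k)) := hm.injOn
  have hdeg : (Lagrange.basis Finset.univ m j).natDegree < k := by
    have := j.isLt
    rw [Lagrange.natDegree_basis hinj (Finset.mem_univ j), Finset.card_univ, Fintype.card_fin]
    omega
  simp only [Matrix.mul_apply, Matrix.of_apply]
  rw [Fin.sum_univ_eq_sum_range
    (fun i => (Lagrange.basis Finset.univ m j).coeff i * m l ^ i) k,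
    ← Polynomial.eval_eq_sum_range' hdeg]
  rcases eq_or_ne j l with rfl | h
  · rw [Lagrange.eval_basis_self hinj (Finset.mem_univ j), Matrix.one_apply_eq]
  · rw [Lagrange.eval_basis_of_ne h (Finset.mem_univ l), Matrix.one_apply_ne h]

/-- Let `ζ > 0` and let `m ∈ [0,1]ᵏ` be `ζ`-separated. Then the Vandermonde matrix `V`
whose rows are the Hadamard powers `m^{⊙i}`, `i = 0, 1, …, k−1` (i.e. `V i j = (m j)^i`),
is invertible and `‖V⁻¹‖ ≤ 2ᵏ / ζ^(k−1)`. -/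
theorem stmt12 {k : ℕ} (ζ : ℝ) (hζ : 0 < ζ) (m : Fin k → ℝ)
    (hmem : ∀ j, m j ∈ Set.Icc (0 : ℝ) 1)
    (hsep : ∀ i j, i ≠ j → ζ ≤ |m i - m j|) :
    IsUnit (Matrix.of fun (i j : Fin k) => m j ^ (i : ℕ)) ∧
      opNorm (Matrix.of fun (i j : Fin k) => m j ^ (i : ℕ))⁻¹ ≤
        2 ^ k / ζ ^ (k - 1) := by
  have hinj : Function.Injective m := fun i j hij => by
    by_contra h
    have := hsep i j h
    rw [hij, sub_self, abs_zero] at this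
    exact absurd hζ this.not_gt
  have hone : ∀ j, |m j| ≤ 1 := fun j => abs_le.mpr ⟨by linarith [(hmem j).1], (hmem j).2⟩
  have hinv := coeff_basis_mul_vandermonde hinj
  refine ⟨IsUnit.of_mul_eq_one_right _ hinv, ?_⟩
  rw [Matrix.inv_eq_left_inv hinv]
  refine opNorm_le_of_sum_sq_le _ (by positivity) ?_
  simp only [Matrix.of_apply]
  have hrow : ∀ j : Fin k, ∑ i : Fin k, (Lagrange.basis Finset.univ m j).coeff i ^ 2 ≤
      (2 ^ k / ζ ^ (k - 1)) ^ 2 / k := fun j => by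
    have hk : 0 < k := j.pos
    have hk' : (0 : ℝ) < k := by exact_mod_cast hk
    have hP : 0 < ∏ i ∈ Finset.univ.erase j, |m j - m i| := by
      have := pow_le_prod_abs_sub hζ hsep j
      exact lt_of_lt_of_le (by positivity) this
    have hle := card_mul_sq_le_four_mul_prod_abs_sub_sq hζ hsep j
    rw [Fintype.card_fin] at hle
    refine (sum_sq_coeff_basis_le hone j).trans ?_
    have h2 : (2 : ℝ) ^ k = 2 * 2 ^ (k - 1) := by rw [← pow_succ', Nat.sub_add_cancel hk]
    rw [h2, div_pow, div_pow, div_div, div_le_div_iff₀ (by positivity) (by positivity)]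
    have := mul_le_mul_of_nonneg_left hle (sq_nonneg ((2 : ℝ) ^ (k - 1)))
    linarith
  refine (Finset.sum_le_sum fun j _ => hrow j).trans ?_
  rw [Finset.sum_const, Finset.card_univ, Fintype.card_fin, nsmul_eq_mul]
  rcases eq_or_ne k 0 with rfl | hk
  · simp
  · rw [mul_div_cancel₀ _ (Nat.cast_ne_zero.mpr hk)]
end

section
/- Let A ∈ ℝ^{k×k}, let B ∈ ℝ^{k×k} be invertible with rows b_1,…,b_k, let Π ∈ ℝ^{k×k} be diagonal, let m ∈ ℝ^k, and let r ≥ 1. Define the row vector u := m^{⊙(r−1)} B^{−1} and let C′ ∈ ℝ^{k×k} be the matrix whose ℓ-th row is (m ⊙ b_ℓ) Π Aᵀ. Then m^{⊙r} Π Aᵀ = u C′. -/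
open Matrix

/-- The matrix whose rows are `(m ⊙ b_ℓ) M`, for `b_ℓ` the rows of `B`, is `B * diagonal m * M`. -/
theorem of_hadamard_row_vecMul {l n p R : Type*} [CommSemiring R] [Fintype n] [DecidableEq n]
    (B : Matrix l n R) (m : n → R) (M : Matrix n p R) :
    Matrix.of (fun i j => ((fun t => m t * B i t) ᵥ* M) j) = B * Matrix.diagonal m * M := by
  ext i j
  rw [Matrix.mul_apply]
  simp [Matrix.vecMul, dotProduct, Matrix.mul_diagonal, mul_comm (m _)]

/-- Bootstrapping identity: let `B ∈ ℝ^{k×k}` be invertible with rows `b_1, …, b_k`,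
`A ∈ ℝ^{k×k}`, `Π` diagonal, `m ∈ ℝᵏ`, `r ≥ 1`. With `u := m^{⊙(r−1)} B⁻¹` and `C′` the
matrix whose `ℓ`-th row is `(m ⊙ b_ℓ) Π Aᵀ`, we have `m^{⊙r} Π Aᵀ = u C′`. -/
theorem stmt14 {k : ℕ} (A B : Matrix (Fin k) (Fin k) ℝ) (hB : IsUnit B)
    (π : Fin k → ℝ) (m : Fin k → ℝ) (r : ℕ) (hr : 1 ≤ r) :
    (fun j => m j ^ r) ᵥ* (Matrix.diagonal π * Aᵀ) =
      ((fun j => m j ^ (r - 1)) ᵥ* B⁻¹) ᵥ*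
        Matrix.of (fun ℓ j => ((fun t => m t * B ℓ t) ᵥ* (Matrix.diagonal π * Aᵀ)) j) := by
  have hdet : IsUnit B.det := (Matrix.isUnit_iff_isUnit_det B).mp hB
  rw [of_hadamard_row_vecMul, Matrix.vecMul_vecMul, Matrix.mul_assoc B,
    Matrix.nonsing_inv_mul_cancel_left _ _ hdet, ← Matrix.vecMul_vecMul _ (Matrix.diagonal m)]
  congr 1
  ext j
  rw [Matrix.vecMul_diagonal, pow_sub_one_mul (Nat.one_le_iff_ne_zero.mp hr)]
end

section
/- Let k ≥ 2, ζ > 0, n ≥ 3k−3, and let m_1,…,m_n ∈ [0,1]^k be such that at least 3k−3 of them are ζ-separated. Let π ∈ ℝ^k be a probability vector with all entries at least π_min > 0, and Π := diag(π). Then there exist pairwise disjoint sets S, T, T′ ⊆ [n] of size k−1 each, and families 𝒜 ⊆ 2^S, ℬ ⊆ 2^T, ℬ′ ⊆ 2^{T′} each of size k and each containing ∅, such that the k×k matrices A := M[𝒜], B := M[ℬ], B′ := M[ℬ′] (whose rows are the Hadamard products m_R over the respective subsets R, with m_∅ = 𝟙 as first row) satisfy: σ_k(A), σ_k(B), σ_k(B′)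 ≥ β^k · 2^{−3k/2} · k^{−3/2}; σ_max(A), σ_max(B), σ_max(B′) ≤ k; and the matrices C_ℬ𝒜 := B Π Aᵀ and C_ℬ′𝒜 := B′ Π Aᵀ satisfy σ_max(C_ℬ𝒜), σ_max(C_ℬ′𝒜) ≤ k² and σ_k(C_ℬ𝒜), σ_k(C_ℬ′𝒜) ≥ β^{2k} · 2^{−3k} · k^{−3} · π_min. -/
open Matrix

theorem abs_le_of_abs_sum_prod_le {ι κ : Type*} [Fintype κ] [DecidableEq κ] [DecidableEq ι]
    {m : ι → κ → ℝ} (hmem : ∀ i a, m i a ∈ Set.Icc (0 : ℝ) 1) {ζ : ℝ} (hζ : 0 < ζ) (j : κ)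
    (S : Finset ι) (hsep : ∀ i ∈ S, ∀ a b, a ≠ b → ζ ≤ |m i a - m i b|) :
    ∀ (J : Finset κ), j ∉ J → J.card = S.card → ∀ (z : κ → ℝ), (∀ a, a ≠ j → a ∉ J → z a = 0) →
      ∀ c : ℝ, (∀ R ⊆ S, |∑ a, (∏ i ∈ R, m i a) * z a| ≤ c) → (ζ / 2) ^ S.card * |z j| ≤ c := by
  induction S using Finset.induction_on with
  | empty =>
    intro J hj hJ z hz c hc
    have h := hc ∅ subset_rfl
    obtain rfl : J = ∅ := by simpa using hJ
    rw [Finset.sum_eq_single j (fun a _ ha => by simp [hz a ha]) (by simp)] at h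
    simpa using h
  | insert i S hi ih =>
    intro J hj hJ z hz c hc
    rw [Finset.card_insert_of_notMem hi] at hJ ⊢
    obtain ⟨b, hb⟩ : J.Nonempty := Finset.card_pos.mp (by omega)
    have hbj : b ≠ j := fun h => hj (h ▸ hb)
    have key := ih (fun i' hi' => hsep i' (Finset.mem_insert_of_mem hi')) (J.erase b)
      (fun h => hj (Finset.mem_of_mem_erase h)) (by rw [Finset.card_erase_of_mem hb]; omega)
      (fun a => (m i a - m i b) * z a) (by
        intro a ha haJ
        by_cases hab : a = b
        · simp [hab]
        · simp [hz a ha fun h => haJ (Finset.mem_erase.mpr ⟨hab, h⟩)]) (2 * c) (by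
        intro R hR
        have h₁ := hc (insert i R) (Finset.insert_subset_insert i hR)
        have h₂ := hc R (hR.trans (Finset.subset_insert i S))
        have hiR : i ∉ R := fun h => hi (hR h)
        have e : ∑ a, (∏ i ∈ R, m i a) * ((m i a - m i b) * z a)
            = ∑ a, (∏ i ∈ insert i R, m i a) * z a - m i b * ∑ a, (∏ i ∈ R, m i a) * z a := by
          rw [Finset.mul_sum, ← Finset.sum_sub_distrib]
          refine Finset.sum_congr rfl fun a _ => ?_
          rw [Finset.prod_insert hiR]
          ring
        rw [e]
        have h₃ : |m i b * ∑ a, (∏ i ∈ R, m i a) * z a| ≤ c := by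
          rw [abs_mul, abs_of_nonneg (hmem i b).1]
          exact (mul_le_of_le_one_left (abs_nonneg _) (hmem i b).2).trans h₂
        exact (abs_sub _ _).trans (by linarith))
    have hs := hsep i (Finset.mem_insert_self i S) j b hbj.symm
    rw [abs_mul] at key
    have h₄ : (ζ / 2) ^ S.card * (ζ * |z j|) ≤ 2 * c := le_trans (by gcongr) key
    rw [pow_succ]
    linarith

theorem exists_det_ne_zero_of_span_eq_top {ι κ : Type*} [Fintype κ] [DecidableEq κ]
    (v : ι → κ → ℝ) (t : Set ι) (i₀ : ι) (hi₀ : i₀ ∈ t) (hv : v i₀ ≠ 0)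
    (ht : Submodule.span ℝ (v '' t) = ⊤) :
    ∃ e : κ → ι, (∀ a, e a ∈ t) ∧ (∃ a, e a = i₀) ∧ (Matrix.of fun a => v (e a)).det ≠ 0 := by
  obtain ⟨b, hbt, hib, hspan, hli⟩ := exists_linearIndepOn_extension (K := ℝ) (v := v)
    (s := {i₀}) (t := t) (LinearIndepOn.singleton hv) (by simpa using hi₀)
  have htop : ⊤ ≤ Submodule.span ℝ (Set.range fun x : b => v x) := by
    rw [← ht, Submodule.span_le]
    rwa [Set.image_eq_range v b] at hspan
  let B := Module.Basis.mk hli htop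
  have e := B.indexEquiv (Pi.basisFun ℝ κ)
  refine ⟨fun a => e.symm a, fun a => hbt (e.symm a).2, ⟨e ⟨i₀, hib rfl⟩, by simp⟩, ?_⟩
  have hli' : LinearIndependent ℝ (Matrix.of fun a => v (e.symm a)).row :=
    LinearIndependent.comp hli e.symm e.symm.injective
  exact ((Matrix.isUnit_iff_isUnit_det _).mp
    (Matrix.linearIndependent_rows_iff_isUnit.mp hli')).ne_zero

theorem span_eq_top_of_forall_sum_eq_zero {κ : Type*} [Fintype κ] [DecidableEq κ]
    (s : Set (κ → ℝ)) (h : ∀ z : κ → ℝ, (∀ x ∈ s, ∑ a, x a * z a = 0) → z = 0) :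
    Submodule.span ℝ s = ⊤ := by
  by_contra hne
  obtain ⟨f, hf, hker⟩ := Submodule.exists_le_ker_of_lt_top _ (lt_top_iff_ne_top.mpr hne)
  have hfs : ∀ x : κ → ℝ, f x = ∑ a, x a * f (Pi.single a 1) := fun x => by
    rw [LinearMap.pi_apply_eq_sum_univ f x]
    refine Finset.sum_congr rfl fun a _ => ?_
    rw [smul_eq_mul]
    congr 2
    ext b
    simp [Pi.single_apply, eq_comm]
  have hz := h (fun a => f (Pi.single a 1)) fun x hx => by
    rw [← hfs]
    exact hker (Submodule.subset_span hx)
  refine hf (LinearMap.ext fun x => ?_)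
  rw [hfs]
  exact Finset.sum_eq_zero fun a _ => by rw [show f (Pi.single a 1) = 0 from congrFun hz a, mul_zero]

/-- If no row of `A` other than the all-ones row `a₀` can be replaced by `x ∈ [0,1]^κ` so as to
increase `|det A|`, then `⟨x, z⟩` is controlled by the entries of `A z`. -/
theorem abs_sum_mul_le_of_det_updateRow_le {κ : Type*} [Fintype κ] [DecidableEq κ]
    {A : Matrix κ κ ℝ} (hA : ∀ a b, A a b ∈ Set.Icc (0 : ℝ) 1) (hdet : A.det ≠ 0)
    {a₀ : κ} (ha₀ : ∀ b, A a₀ b = 1) {x : κ → ℝ} (hx : ∀ b, x b ∈ Set.Icc (0 : ℝ) 1)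
    (hmax : ∀ a, a ≠ a₀ → |(A.updateRow a x).det| ≤ |A.det|) (z : κ → ℝ) {c : ℝ}
    (hc : ∀ a, |(A *ᵥ z) a| ≤ c) :
    |∑ b, x b * z b| ≤ 2 * Fintype.card κ * c := by
  have hc0 : 0 ≤ c := (abs_nonneg _).trans (hc a₀)
  set w : κ → ℝ := fun a => (A.updateRow a x).det / A.det with hw
  have hwx : ∀ b, ∑ a, w a * A a b = x b := fun b => by
    have h := congrFun (Matrix.mulVec_cramer Aᵀ x) b
    simp only [Matrix.mulVec, dotProduct, Matrix.transpose_apply, Matrix.cramer_transpose_apply,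
      Matrix.det_transpose, Pi.smul_apply, smul_eq_mul] at h
    simp only [hw, div_mul_eq_mul_div, ← Finset.sum_div]
    rw [div_eq_iff hdet, mul_comm (x b), ← h]
    exact Finset.sum_congr rfl fun a _ => mul_comm _ _
  have hw1 : ∀ a, a ≠ a₀ → |w a| ≤ 1 := fun a ha => by
    rw [hw, abs_div]
    exact div_le_one_of_le₀ (hmax a ha) (abs_nonneg _)
  have hsum : ∑ a ∈ Finset.univ.erase a₀, |w a| ≤ Fintype.card κ - 1 := by
    refine (Finset.sum_le_card_nsmul _ _ 1 fun a ha => hw1 a (Finset.ne_of_mem_erase ha)).trans ?_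
    rw [Finset.card_erase_of_mem (Finset.mem_univ _), Finset.card_univ, nsmul_eq_mul, mul_one,
      Nat.cast_sub (Fintype.card_pos_iff.mpr ⟨a₀⟩), Nat.cast_one]
  have hw0 : |w a₀| ≤ Fintype.card κ := by
    have h := hwx a₀
    rw [← Finset.add_sum_erase _ _ (Finset.mem_univ a₀), ha₀, mul_one] at h
    have h₁ : |∑ a ∈ Finset.univ.erase a₀, w a * A a a₀| ≤ Fintype.card κ - 1 := by
      refine (Finset.abs_sum_le_sum_abs _ _).trans (le_trans ?_ hsum)
      refine Finset.sum_le_sum fun a _ => ?_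
      rw [abs_mul, abs_of_nonneg (hA a a₀).1]
      exact mul_le_of_le_one_right (abs_nonneg _) (hA a a₀).2
    rw [abs_le] at h₁ ⊢
    constructor <;> linarith [(hx a₀).1, (hx a₀).2, h₁.1, h₁.2]
  have hall : ∑ a, |w a| ≤ 2 * Fintype.card κ := by
    rw [← Finset.add_sum_erase _ _ (Finset.mem_univ a₀)]
    linarith
  have hxz : ∑ b, x b * z b = ∑ a, w a * (A *ᵥ z) a := by
    simp only [Matrix.mulVec, dotProduct, Finset.mul_sum]
    rw [Finset.sum_comm]
    refine Finset.sum_congr rfl fun b _ => ?_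
    rw [← hwx b, Finset.sum_mul]
    exact Finset.sum_congr rfl fun a _ => mul_assoc _ _ _
  rw [hxz]
  calc |∑ a, w a * (A *ᵥ z) a| ≤ ∑ a, |w a * (A *ᵥ z) a| := Finset.abs_sum_le_sum_abs _ _
    _ ≤ ∑ a, |w a| * c := Finset.sum_le_sum fun a _ => by
        rw [abs_mul]
        exact mul_le_mul_of_nonneg_left (hc a) (abs_nonneg _)
    _ ≤ 2 * Fintype.card κ * c := by
        rw [← Finset.sum_mul]
        exact mul_le_mul_of_nonneg_right hall hc0

theorem norm_toLp_le_sqrt_mul {κ : Type*} [Fintype κ] (z : κ → ℝ) {c : ℝ} (hc0 : 0 ≤ c)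
    (hc : ∀ a, |z a| ≤ c) : ‖WithLp.toLp 2 z‖ ≤ √(Fintype.card κ) * c := by
  rw [EuclideanSpace.norm_eq, ← Real.sqrt_sq hc0, ← Real.sqrt_mul (Nat.cast_nonneg _)]
  refine Real.sqrt_le_sqrt ?_
  refine (Finset.sum_le_card_nsmul _ _ (c ^ 2) fun a _ => ?_).trans (by simp)
  exact pow_le_pow_left₀ (norm_nonneg _) (hc a) 2

/-- From `k - 1` separated vectors in `[0,1]ᵏ` one can select `k` Hadamard products, among them
the empty one, that form a well-conditioned matrix. -/
theorem exists_hadamard_family {ι κ : Type*} [Fintype ι] [DecidableEq ι] [Fintype κ]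
    [DecidableEq κ] [Nonempty κ] {m : ι → κ → ℝ} (hmem : ∀ i a, m i a ∈ Set.Icc (0 : ℝ) 1)
    {ζ : ℝ} (hζ : 0 < ζ) (S : Finset ι) (hS : S.card = Fintype.card κ - 1)
    (hsep : ∀ i ∈ S, ∀ a b, a ≠ b → ζ ≤ |m i a - m i b|) :
    ∃ 𝒜 : κ → Finset ι, Function.Injective 𝒜 ∧ (∀ a, 𝒜 a ⊆ S) ∧ (∃ a, 𝒜 a = ∅) ∧
      ∀ z : κ → ℝ, (ζ / 2) ^ (Fintype.card κ - 1) / (2 * Fintype.card κ * √(Fintype.card κ)) *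
        ‖WithLp.toLp 2 z‖ ≤ ‖WithLp.toLp 2 ((Matrix.of fun a j => ∏ i ∈ 𝒜 a, m i j) *ᵥ z)‖ := by
  have hbound : ∀ (z : κ → ℝ) (c : ℝ), (∀ R ⊆ S, |∑ a, (∏ i ∈ R, m i a) * z a| ≤ c) →
      ∀ j, (ζ / 2) ^ (Fintype.card κ - 1) * |z j| ≤ c := fun z c hc j => by
    rw [← hS]
    exact abs_le_of_abs_sum_prod_le hmem hζ j S hsep (Finset.univ.erase j) (by simp)
      (by simp [hS]) z (fun a ha haJ => absurd haJ (by simp [ha])) c hc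
  have hprod : ∀ (R : Finset ι) b, ∏ i ∈ R, m i b ∈ Set.Icc (0 : ℝ) 1 := fun R b =>
    ⟨Finset.prod_nonneg fun i _ => (hmem i b).1,
      Finset.prod_le_one (fun i _ => (hmem i b).1) fun i _ => (hmem i b).2⟩
  let v : Finset ι → κ → ℝ := fun R j => ∏ i ∈ R, m i j
  have hγ : 0 < (ζ / 2) ^ (Fintype.card κ - 1) := by positivity
  have hspan : Submodule.span ℝ (v '' {R | R ⊆ S}) = ⊤ := by
    refine span_eq_top_of_forall_sum_eq_zero _ fun z hz => funext fun j => ?_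
    have h := hbound z 0 (fun R hR => by rw [hz (v R) ⟨R, hR, rfl⟩, abs_zero]) j
    exact abs_nonpos_iff.mp (nonpos_of_mul_nonpos_right h hγ)
  obtain ⟨e, heS, ⟨a₀, hea⟩, hdet⟩ := exists_det_ne_zero_of_span_eq_top v {R | R ⊆ S} ∅
    (Finset.empty_subset S) (by
      obtain ⟨j⟩ := ‹Nonempty κ›
      intro h
      simpa [v] using congrFun h j) hspan
  obtain ⟨𝒜, h𝒜, hmax⟩ := Finset.exists_max_image
    (Finset.univ.filter fun f : κ → Finset ι => (∀ a, f a ⊆ S) ∧ f a₀ = ∅)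
    (fun f => |(Matrix.of fun a => v (f a)).det|) ⟨e, by simpa using ⟨heS, hea⟩⟩
  simp only [Finset.mem_filter, Finset.mem_univ, true_and] at h𝒜 hmax
  have hdet𝒜 : (Matrix.of fun a => v (𝒜 a)).det ≠ 0 :=
    abs_pos.mp ((abs_pos.mpr hdet).trans_le (hmax e ⟨heS, hea⟩))
  refine ⟨𝒜, fun a b hab => ?_, h𝒜.1, ⟨a₀, h𝒜.2⟩, fun z => ?_⟩
  · by_contra hne
    exact hdet𝒜 (Matrix.det_zero_of_row_eq hne (by ext j; simp [hab]))
  set A : Matrix κ κ ℝ := Matrix.of fun a j => ∏ i ∈ 𝒜 a, m i j with hA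
  have hk : (0 : ℝ) < Fintype.card κ := Nat.cast_pos.mpr Fintype.card_pos
  set c := ‖WithLp.toLp 2 (A *ᵥ z)‖
  have hc : ∀ a, |(A *ᵥ z) a| ≤ c := fun a => PiLp.norm_apply_le (WithLp.toLp 2 (A *ᵥ z)) a
  have hR : ∀ R ⊆ S, |∑ a, (∏ i ∈ R, m i a) * z a| ≤ 2 * Fintype.card κ * c := fun R hRS => by
    refine abs_sum_mul_le_of_det_updateRow_le (A := A) (fun a b => hprod _ b) hdet𝒜 (a₀ := a₀)
      (fun b => by simp [hA, h𝒜.2]) (fun b => hprod R b) (fun a ha => ?_) z hc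
    have h := hmax (Function.update 𝒜 a R) ⟨fun b => ?_, ?_⟩
    · have hrow : (A.updateRow a fun b => ∏ i ∈ R, m i b) =
          Matrix.of fun b => v (Function.update 𝒜 a R b) := by
        ext b j
        by_cases hb : b = a
        · subst hb; simp [v]
        · simp [hA, v, hb]
      rwa [hrow]
    · by_cases hb : b = a
      · subst hb; simpa using hRS
      · simpa [hb] using h𝒜.1 b
    · rw [Function.update_of_ne (Ne.symm ha), h𝒜.2]
  have hz := norm_toLp_le_sqrt_mul z
    (c := 2 * Fintype.card κ * c / (ζ / 2) ^ (Fintype.card κ - 1)) (by positivity)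
    fun j => by
      rw [le_div_iff₀ hγ, mul_comm]
      exact hbound z _ hR j
  rw [div_mul_eq_mul_div, div_le_iff₀ (by positivity)]
  rw [← mul_div_assoc, le_div_iff₀ hγ] at hz
  linarith

theorem mulVec_transpose_lower_bound {κ : Type*} [Fintype κ] [DecidableEq κ] {A : Matrix κ κ ℝ}
    {s : ℝ} (hs : 0 < s) (hA : ∀ z : κ → ℝ, s * ‖WithLp.toLp 2 z‖ ≤ ‖WithLp.toLp 2 (A *ᵥ z)‖)
    (y : κ → ℝ) : s * ‖WithLp.toLp 2 y‖ ≤ ‖WithLp.toLp 2 (Aᵀ *ᵥ y)‖ := by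
  have hinj : Function.Injective A.mulVecLin := by
    rw [← LinearMap.ker_eq_bot, LinearMap.ker_eq_bot']
    intro z hz
    have h := hA z
    rw [show A *ᵥ z = 0 from hz, WithLp.toLp_zero, norm_zero] at h
    simpa using nonpos_of_mul_nonpos_right h hs
  obtain ⟨z, rfl⟩ := LinearMap.injective_iff_surjective.mp hinj y
  rw [Matrix.mulVecLin_apply]
  have hz := hA z
  set y := A *ᵥ z with hy
  have hin : ‖WithLp.toLp 2 y‖ ^ 2 ≤ ‖WithLp.toLp 2 (Aᵀ *ᵥ y)‖ * ‖WithLp.toLp 2 z‖ := by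
    refine le_trans (le_of_eq ?_)
      (real_inner_le_norm (WithLp.toLp 2 (Aᵀ *ᵥ y)) (WithLp.toLp 2 z))
    rw [← real_inner_self_eq_norm_sq, EuclideanSpace.inner_eq_star_dotProduct,
      EuclideanSpace.inner_eq_star_dotProduct]
    simp only [star_trivial, Matrix.mulVec_transpose]
    rw [dotProduct_comm z, ← Matrix.dotProduct_mulVec]
  by_cases h0 : ‖WithLp.toLp 2 y‖ = 0
  · rw [h0, mul_zero]
    exact norm_nonneg _
  · have hpos : 0 < ‖WithLp.toLp 2 y‖ := lt_of_le_of_ne (norm_nonneg _) (Ne.symm h0)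
    refine le_of_mul_le_mul_right ?_ hpos
    calc s * ‖WithLp.toLp 2 y‖ * ‖WithLp.toLp 2 y‖ = s * ‖WithLp.toLp 2 y‖ ^ 2 := by ring
      _ ≤ s * (‖WithLp.toLp 2 (Aᵀ *ᵥ y)‖ * ‖WithLp.toLp 2 z‖) := by gcongr
      _ = ‖WithLp.toLp 2 (Aᵀ *ᵥ y)‖ * (s * ‖WithLp.toLp 2 z‖) := by ring
      _ ≤ ‖WithLp.toLp 2 (Aᵀ *ᵥ y)‖ * ‖WithLp.toLp 2 y‖ := by gcongr

theorem norm_mulVec_le_card_mul {κ : Type*} [Fintype κ] {A : Matrix κ κ ℝ}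
    (hA : ∀ a b, |A a b| ≤ 1) (z : κ → ℝ) :
    ‖WithLp.toLp 2 (A *ᵥ z)‖ ≤ Fintype.card κ * ‖WithLp.toLp 2 z‖ := by
  have h : ∀ a, |(A *ᵥ z) a| ≤ √(Fintype.card κ) * ‖WithLp.toLp 2 z‖ := fun a => by
    have hrow : ‖WithLp.toLp 2 (A a)‖ ≤ √(Fintype.card κ) := by
      simpa using norm_toLp_le_sqrt_mul (A a) zero_le_one (hA a)
    have hin := abs_real_inner_le_norm (WithLp.toLp 2 z) (WithLp.toLp 2 (A a))
    rw [EuclideanSpace.inner_eq_star_dotProduct] at hin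
    simp only [star_trivial] at hin
    refine hin.trans ?_
    rw [mul_comm]
    gcongr
  refine (norm_toLp_le_sqrt_mul _ (by positivity) h).trans (le_of_eq ?_)
  rw [← mul_assoc, Real.mul_self_sqrt (Nat.cast_nonneg _)]

theorem norm_diagonal_mulVec_le {κ : Type*} [Fintype κ] [DecidableEq κ] {d : κ → ℝ}
    (hd : ∀ a, |d a| ≤ 1) (z : κ → ℝ) :
    ‖WithLp.toLp 2 (Matrix.diagonal d *ᵥ z)‖ ≤ ‖WithLp.toLp 2 z‖ := by
  rw [EuclideanSpace.norm_eq, EuclideanSpace.norm_eq]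
  gcongr with a
  rw [PiLp.toLp_apply, Matrix.mulVec_diagonal, norm_mul]
  exact mul_le_of_le_one_left (norm_nonneg _) (hd a)

theorem le_norm_diagonal_mulVec {κ : Type*} [Fintype κ] [DecidableEq κ] {d : κ → ℝ} {c : ℝ}
    (hc : 0 ≤ c) (hd : ∀ a, c ≤ d a) (z : κ → ℝ) :
    c * ‖WithLp.toLp 2 z‖ ≤ ‖WithLp.toLp 2 (Matrix.diagonal d *ᵥ z)‖ := by
  rw [EuclideanSpace.norm_eq, EuclideanSpace.norm_eq, ← Real.sqrt_sq hc,
    ← Real.sqrt_mul (sq_nonneg c), Finset.mul_sum]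
  refine Real.sqrt_le_sqrt (Finset.sum_le_sum fun a _ => ?_)
  rw [PiLp.toLp_apply, PiLp.toLp_apply, Matrix.mulVec_diagonal, norm_mul, mul_pow, Real.norm_of_nonneg (hc.trans (hd a))]
  have := hd a
  gcongr

theorem sigmaMax_le {κ : Type*} [Fintype κ] [DecidableEq κ] {A : Matrix κ κ ℝ} {c : ℝ}
    (hc : 0 ≤ c) (h : ∀ z : κ → ℝ, ‖WithLp.toLp 2 (A *ᵥ z)‖ ≤ c * ‖WithLp.toLp 2 z‖) :
    sigmaMax A ≤ c := by
  refine Real.sSup_le ?_ hc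
  rintro _ ⟨z, hz, rfl⟩
  have := h z.ofLp
  rwa [WithLp.toLp_ofLp, hz, mul_one] at this

theorem le_sigmaMin {κ : Type*} [Fintype κ] [DecidableEq κ] [Nonempty κ] {A : Matrix κ κ ℝ}
    {c : ℝ} (h : ∀ z : κ → ℝ, c * ‖WithLp.toLp 2 z‖ ≤ ‖WithLp.toLp 2 (A *ᵥ z)‖) :
    c ≤ sigmaMin A := by
  obtain ⟨j⟩ := ‹Nonempty κ›
  refine le_csInf ⟨_, EuclideanSpace.single j 1, by simp, rfl⟩ ?_
  rintro _ ⟨z, hz, rfl⟩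
  have := h z.ofLp
  rwa [WithLp.toLp_ofLp, hz, mul_one] at this

theorem norm_mul_diagonal_mul_transpose_le {κ : Type*} [Fintype κ] [DecidableEq κ]
    {A B : Matrix κ κ ℝ} {d : κ → ℝ} (hA : ∀ a b, |A a b| ≤ 1) (hB : ∀ a b, |B a b| ≤ 1)
    (hd : ∀ a, |d a| ≤ 1) (z : κ → ℝ) :
    ‖WithLp.toLp 2 ((B * Matrix.diagonal d * Aᵀ) *ᵥ z)‖ ≤
      (Fintype.card κ : ℝ) ^ 2 * ‖WithLp.toLp 2 z‖ := by
  rw [← Matrix.mulVec_mulVec, ← Matrix.mulVec_mulVec, pow_two, mul_assoc]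
  refine (norm_mulVec_le_card_mul hB _).trans ?_
  gcongr
  exact (norm_diagonal_mulVec_le hd _).trans
    (norm_mulVec_le_card_mul (A := Aᵀ) (fun a b => hA b a) z)

theorem le_norm_mul_diagonal_mul_transpose {κ : Type*} [Fintype κ] [DecidableEq κ]
    {A B : Matrix κ κ ℝ} {d : κ → ℝ} {s c : ℝ} (hs : 0 < s) (hc : 0 ≤ c)
    (hA : ∀ z : κ → ℝ, s * ‖WithLp.toLp 2 z‖ ≤ ‖WithLp.toLp 2 (A *ᵥ z)‖)
    (hB : ∀ z : κ → ℝ, s * ‖WithLp.toLp 2 z‖ ≤ ‖WithLp.toLp 2 (B *ᵥ z)‖)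
    (hd : ∀ a, c ≤ d a) (z : κ → ℝ) :
    s ^ 2 * c * ‖WithLp.toLp 2 z‖ ≤
      ‖WithLp.toLp 2 ((B * Matrix.diagonal d * Aᵀ) *ᵥ z)‖ := by
  rw [← Matrix.mulVec_mulVec, ← Matrix.mulVec_mulVec]
  calc s ^ 2 * c * ‖WithLp.toLp 2 z‖ = s * (c * (s * ‖WithLp.toLp 2 z‖)) := by ring
    _ ≤ s * (c * ‖WithLp.toLp 2 (Aᵀ *ᵥ z)‖) := by
        gcongr
        exact mulVec_transpose_lower_bound hs hA z
    _ ≤ s * ‖WithLp.toLp 2 (Matrix.diagonal d *ᵥ (Aᵀ *ᵥ z))‖ := by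
        gcongr
        exact le_norm_diagonal_mulVec hc hd _
    _ ≤ _ := hB _

theorem beta_pos (k : ℕ) (hk : 2 ≤ k) {ζ : ℝ} (hζ : 0 < ζ) : 0 < beta k ζ := by
  have : (0 : ℝ) < k := by positivity
  unfold beta
  positivity

theorem beta_le (k : ℕ) (hk : 2 ≤ k) {ζ : ℝ} (hζ : 0 < ζ) : beta k ζ ≤ (ζ / 2) ^ (k - 1) := by
  have hk1 : (1 : ℝ) ≤ (k : ℝ) ^ 3 := one_le_pow₀ (by exact_mod_cast (by omega : 1 ≤ k))
  exact div_le_self (by positivity) (by linarith)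

theorem lowσ_le {k : ℕ} (hk : 2 ≤ k) {ζ : ℝ} (hζ : 0 < ζ) (hζ1 : ζ ≤ 1) :
    beta k ζ ^ k * (2 : ℝ) ^ (-(3 * (k : ℝ)) / 2) * (k : ℝ) ^ (-(3 : ℝ) / 2) ≤
      (ζ / 2) ^ (k - 1) / (2 * k * √k) := by
  have hk0 : (0 : ℝ) < k := by positivity
  have hk2 : (2 : ℝ) ≤ k := by exact_mod_cast hk
  have hβ := beta_pos k hk hζ
  have hβγ := beta_le k hk hζ
  have hβ1 : beta k ζ ≤ 1 := hβγ.trans (pow_le_one₀ (by positivity) (by linarith))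
  have h₁ : beta k ζ ^ k ≤ (ζ / 2) ^ (k - 1) :=
    (pow_le_of_le_one hβ.le hβ1 (by omega)).trans hβγ
  have h₂ : (2 : ℝ) ^ (-(3 * (k : ℝ)) / 2) ≤ 2⁻¹ := by
    rw [← Real.rpow_neg_one]
    exact Real.rpow_le_rpow_of_exponent_le (by norm_num) (by linarith)
  have h₃ : (k : ℝ) ^ (-(3 : ℝ) / 2) = (k * √k)⁻¹ := by
    rw [Real.sqrt_eq_rpow, ← Real.rpow_one_add' hk0.le (by norm_num), ← Real.rpow_neg hk0.le]
    norm_num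
  rw [h₃]
  calc beta k ζ ^ k * (2 : ℝ) ^ (-(3 * (k : ℝ)) / 2) * (k * √k)⁻¹
      ≤ (ζ / 2) ^ (k - 1) * 2⁻¹ * (k * √k)⁻¹ := by gcongr
    _ = _ := by rw [mul_assoc, ← mul_inv, ← mul_assoc 2, div_eq_mul_inv (_ ^ _)]

theorem lowσ_sq_le {k : ℕ} (hk : 2 ≤ k) {ζ : ℝ} (hζ : 0 < ζ) (hζ1 : ζ ≤ 1) :
    beta k ζ ^ (2 * k) / 2 ^ (3 * k) / (k : ℝ) ^ 3 ≤
      ((ζ / 2) ^ (k - 1) / (2 * k * √k)) ^ 2 := by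
  have hk0 : (0 : ℝ) < k := by positivity
  have hβ := beta_pos k hk hζ
  refine le_trans (le_of_eq ?_) (pow_le_pow_left₀ (by positivity) (lowσ_le hk hζ hζ1) 2)
  have h₂ : ((2 : ℝ) ^ (-(3 * (k : ℝ)) / 2)) ^ 2 = (2 ^ (3 * k))⁻¹ := by
    rw [← Real.rpow_natCast, ← Real.rpow_mul (by norm_num), ← Real.rpow_natCast,
      ← Real.rpow_neg (by norm_num)]
    congr 1
    push_cast
    ring
  have h₃ : ((k : ℝ) ^ (-(3 : ℝ) / 2)) ^ 2 = ((k : ℝ) ^ 3)⁻¹ := by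
    rw [← Real.rpow_natCast, ← Real.rpow_mul hk0.le, ← Real.rpow_natCast (k : ℝ) 3,
      ← Real.rpow_neg hk0.le]
    norm_num
  rw [mul_pow, mul_pow, h₂, h₃, ← pow_mul, mul_comm k 2, div_eq_mul_inv, div_eq_mul_inv]

theorem exists_three_disjoint_subsets {ι : Type*} [DecidableEq ι] {D : Finset ι} {r : ℕ}
    (h : 3 * r ≤ D.card) : ∃ S T T' : Finset ι, S ⊆ D ∧ T ⊆ D ∧ T' ⊆ D ∧
      Disjoint S T ∧ Disjoint S T' ∧ Disjoint T T' ∧ S.card = r ∧ T.card = r ∧ T'.card = r := by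
  obtain ⟨S, hS, hSr⟩ := Finset.exists_subset_card_eq (show r ≤ D.card by omega)
  have h₁ := Finset.card_sdiff_of_subset hS
  obtain ⟨T, hT, hTr⟩ := Finset.exists_subset_card_eq (show r ≤ (D \ S).card by omega)
  have h₂ := Finset.card_sdiff_of_subset hT
  obtain ⟨T', hT', hTr'⟩ := Finset.exists_subset_card_eq (show r ≤ ((D \ S) \ T).card by omega)
  have hT'S := hT'.trans Finset.sdiff_subset
  exact ⟨S, T, T', hS, hT.trans Finset.sdiff_subset, hT'S.trans Finset.sdiff_subset,
    (Finset.disjoint_sdiff).mono_right hT, (Finset.disjoint_sdiff).mono_right hT'S,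
    (Finset.disjoint_sdiff).mono_right hT', hSr, hTr, hTr'⟩

/-- Core stability bound for the algorithm: given `n ≥ 3k−3` observables `m_i ∈ [0,1]ᵏ`
of which at least `3k−3` are `ζ`-separated, and a mixing-weight vector `π` with entries
at least `π_min > 0` summing to `1`, there are pairwise disjoint sets `S, T, T′ ⊆ [n]` of
size `k−1` and families `𝒜 ⊆ 2^S`, `ℬ ⊆ 2^T`, `ℬ′ ⊆ 2^{T′}` of `k` distinct subsets,
each containing `∅`, such that the `k × k` matrices `A, B, B′` with rows the Hadamard
products `m_R` (over `R` in the respective family, `m_∅ = 𝟙`) satisfy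
`σ_k ≥ βᵏ·2^(−3k/2)·k^(−3/2)` and `σ_max ≤ k`, and `C_ℬ𝒜 = B Π Aᵀ`,
`C_ℬ′𝒜 = B′ Π Aᵀ` satisfy `σ_max ≤ k²` and `σ_k ≥ β^{2k}·2^(−3k)·k^(−3)·π_min`. -/
theorem stmt16 {k n : ℕ} (hk : 2 ≤ k) (hn : 3 * k - 3 ≤ n) (ζ : ℝ) (hζ : 0 < ζ)
    (m : Fin n → Fin k → ℝ) (hmem : ∀ i j, m i j ∈ Set.Icc (0 : ℝ) 1)
    (hsep : ∃ D : Finset (Fin n), 3 * k - 3 ≤ D.card ∧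
      ∀ i ∈ D, ∀ a b, a ≠ b → ζ ≤ |m i a - m i b|)
    (π : Fin k → ℝ) (πmin : ℝ) (hπmin : 0 < πmin) (hπ : ∀ j, πmin ≤ π j)
    (hπsum : ∑ j, π j = 1) :
    ∃ S T T' : Finset (Fin n),
      Disjoint S T ∧ Disjoint S T' ∧ Disjoint T T' ∧
      S.card = k - 1 ∧ T.card = k - 1 ∧ T'.card = k - 1 ∧
      ∃ 𝒜 ℬ ℬ' : Fin k → Finset (Fin n),
        Function.Injective 𝒜 ∧ Function.Injective ℬ ∧ Function.Injective ℬ' ∧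
        (∀ a, 𝒜 a ⊆ S) ∧ (∀ a, ℬ a ⊆ T) ∧ (∀ a, ℬ' a ⊆ T') ∧
        (∃ a, 𝒜 a = ∅) ∧ (∃ a, ℬ a = ∅) ∧ (∃ a, ℬ' a = ∅) ∧
        (let A : Matrix (Fin k) (Fin k) ℝ := Matrix.of fun a j => ∏ i ∈ 𝒜 a, m i j
         let B : Matrix (Fin k) (Fin k) ℝ := Matrix.of fun a j => ∏ i ∈ ℬ a, m i j
         let B' : Matrix (Fin k) (Fin k) ℝ := Matrix.of fun a j => ∏ i ∈ ℬ' a, m i j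
         let lowσ : ℝ := beta k ζ ^ k * (2 : ℝ) ^ (-(3 * (k : ℝ)) / 2) * (k : ℝ) ^ (-(3 : ℝ) / 2)
         lowσ ≤ sigmaMin A ∧ lowσ ≤ sigmaMin B ∧ lowσ ≤ sigmaMin B' ∧
         sigmaMax A ≤ (k : ℝ) ∧ sigmaMax B ≤ (k : ℝ) ∧ sigmaMax B' ≤ (k : ℝ) ∧
         sigmaMax (B * Matrix.diagonal π * Aᵀ) ≤ (k : ℝ) ^ 2 ∧
         sigmaMax (B' * Matrix.diagonal π * Aᵀ) ≤ (k : ℝ) ^ 2 ∧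
         beta k ζ ^ (2 * k) / 2 ^ (3 * k) / (k : ℝ) ^ 3 * πmin ≤
           sigmaMin (B * Matrix.diagonal π * Aᵀ) ∧
         beta k ζ ^ (2 * k) / 2 ^ (3 * k) / (k : ℝ) ^ 3 * πmin ≤
           sigmaMin (B' * Matrix.diagonal π * Aᵀ)) := by
  have : Nonempty (Fin k) := ⟨⟨0, by omega⟩⟩
  obtain ⟨D, hD, hDsep⟩ := hsep
  obtain ⟨S, T, T', hSD, hTD, hTD', hST, hST', hTT', hS, hT, hT'⟩ :=
    exists_three_disjoint_subsets (D := D) (r := k - 1) (by omega)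
  have hζ1 : ζ ≤ 1 := by
    obtain ⟨i, hi⟩ : D.Nonempty := Finset.card_pos.mp (by omega)
    have h := hDsep i hi ⟨0, by omega⟩ ⟨1, by omega⟩ (by simp)
    exact h.trans (abs_sub_le_of_le_of_le (hmem _ _).1 (hmem _ _).2 (hmem _ _).1 (hmem _ _).2
      |>.trans (by norm_num))
  have family := fun (U : Finset (Fin n)) (hUD : U ⊆ D) (hU : U.card = k - 1) =>
    exists_hadamard_family hmem hζ U (by rw [hU, Fintype.card_fin])
      fun i hi => hDsep i (hUD hi)
  simp only [Fintype.card_fin] at family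
  obtain ⟨𝒜, hAi, hAS, hA0, hA⟩ := family S hSD hS
  obtain ⟨ℬ, hBi, hBS, hB0, hB⟩ := family T hTD hT
  obtain ⟨ℬ', hBi', hBS', hB0', hB'⟩ := family T' hTD' hT'
  refine ⟨S, T, T', hST, hST', hTT', hS, hT, hT', 𝒜, ℬ, ℬ', hAi, hBi, hBi', hAS, hBS, hBS',
    hA0, hB0, hB0', ?_⟩
  intro A B B' lowσ
  have hentry : ∀ (F : Fin k → Finset (Fin n)) a b,
      |(Matrix.of fun a j => ∏ i ∈ F a, m i j : Matrix (Fin k) (Fin k) ℝ) a b| ≤ 1 :=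
    fun F a b => by
      rw [Matrix.of_apply, abs_of_nonneg (Finset.prod_nonneg fun i _ => (hmem i b).1)]
      exact Finset.prod_le_one (fun i _ => (hmem i b).1) fun i _ => (hmem i b).2
  have hπ1 : ∀ a, |π a| ≤ 1 := fun a => by
    have hnn : ∀ j, 0 ≤ π j := fun j => hπmin.le.trans (hπ j)
    rw [abs_of_nonneg (hnn a), ← hπsum]
    exact Finset.single_le_sum (fun j _ => hnn j) (Finset.mem_univ a)
  have hs : 0 < (ζ / 2) ^ (k - 1) / (2 * k * √k) := by
    have : (0 : ℝ) < k := by positivity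
    positivity
  have hlow : lowσ ≤ _ := lowσ_le hk hζ hζ1
  have hlow_sq := mul_le_mul_of_nonneg_right (lowσ_sq_le hk hζ hζ1) hπmin.le
  have hmaxk : ∀ F : Fin k → Finset (Fin n),
      sigmaMax (Matrix.of fun a j => ∏ i ∈ F a, m i j : Matrix (Fin k) (Fin k) ℝ) ≤ k := fun F =>
    sigmaMax_le (by positivity) (by simpa using norm_mulVec_le_card_mul (hentry F))
  refine ⟨hlow.trans (le_sigmaMin hA), hlow.trans (le_sigmaMin hB), hlow.trans (le_sigmaMin hB'),
    hmaxk 𝒜, hmaxk ℬ, hmaxk ℬ', ?_, ?_, ?_, ?_⟩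
  · exact sigmaMax_le (by positivity)
      (by simpa using norm_mul_diagonal_mul_transpose_le (hentry 𝒜) (hentry ℬ) hπ1)
  · exact sigmaMax_le (by positivity)
      (by simpa using norm_mul_diagonal_mul_transpose_le (hentry 𝒜) (hentry ℬ') hπ1)
  · exact hlow_sq.trans
      (le_sigmaMin (le_norm_mul_diagonal_mul_transpose hs hπmin.le hA hB hπ))
  · exact hlow_sq.trans
      (le_sigmaMin (le_norm_mul_diagonal_mul_transpose hs hπmin.le hA hB' hπ))
end
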